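/- Let the graph have N ≥ 2 vertices, let V̂^B_0, …, V̂^B_{N−1} be an ε-approximate finite-horizon Bellman sequence, fix s, g ∈ S, and let s_0, …, s_N be the corresponding greedy Bellman path: s_0 = s, s_N = g, and for each 0 ≤ k ≤ N−2, s_{k+1} is a minimizer over s' ∈ S of c(s_k, s') + V̂^B_{N−k−2}(s', g). Then Σ_{k=0}^{N−1} c(s_k, s_{k+1}) ≤ V*(s, g) + (N² − N)·ε, where V*(s,g) is the minimum cost of a path from s to g. -/

import Mathlib

noncomputable section

/-- The finite-horizon Bellman operator:
`(T^B V)(s,g) = min over s' of (c(s,s') + V(s',g))`. -/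
def bellmanOp {S : Type*} [Fintype S] [Nonempty S] (c : S → S → ℝ) (V : S → S → ℝ) :
    S → S → ℝ :=
  fun s g => Finset.univ.inf' Finset.univ_nonempty fun s' => c s s' + V s' g

/-- The cost of a path given as a list of visited vertices:
the sum of edge costs of consecutive vertices. A path with 0 edges has cost 0. -/
def pathCostR {S : Type*} (c : S → S → ℝ) : List S → ℝ
  | [] => 0
  | [_] => 0
  | a :: b :: rest => c a b + pathCostR c (b :: rest)

/-- `V*(s,g)`: the minimum (infimum) cost over all paths from `s` to `g`. -/
def VstarR {S : Type*} (c : S → S → ℝ) (s g : S) : ℝ :=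
  sInf {x | ∃ p : List S, p.head? = some s ∧ p.getLast? = some g ∧ pathCostR c p = x}

theorem pathCostR_le_cons {S : Type*} {c : S → S → ℝ} (hc : ∀ s s', 0 ≤ c s s') (a : S) :
    ∀ p : List S, pathCostR c p ≤ pathCostR c (a :: p)
  | [] => le_rfl
  | b :: _ => le_add_of_nonneg_left (hc a b)

theorem pathCostR_le_append {S : Type*} {c : S → S → ℝ} (hc : ∀ s s', 0 ≤ c s s')
    (p q : List S) : pathCostR c q ≤ pathCostR c (p ++ q) := by
  induction p with
  | nil => exact le_rfl
  | cons a p ih => exact ih.trans (pathCostR_le_cons hc a _)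

/-- Removing cycles: every path can be replaced by a path without repeated vertices, with the same
endpoints and no larger cost. -/
theorem exists_nodup_pathCostR_le {S : Type*} {c : S → S → ℝ} (hc : ∀ s s', 0 ≤ c s s')
    (p : List S) : ∃ q : List S, q.Nodup ∧ q.head? = p.head? ∧ q.getLast? = p.getLast? ∧
      pathCostR c q ≤ pathCostR c p := by
  induction p with
  | nil => exact ⟨[], List.nodup_nil, rfl, rfl, le_rfl⟩
  | cons a p ih =>
    cases p with
    | nil => exact ⟨[a], List.nodup_singleton a, rfl, rfl, le_rfl⟩
    | cons b p =>
      obtain ⟨q, hq, hhead, hlast, hcost⟩ := ih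
      by_cases ha : a ∈ q
      · obtain ⟨l₁, l₂, rfl⟩ := List.append_of_mem ha
        refine ⟨a :: l₂, hq.of_append_right, rfl, ?_, ?_⟩
        · rw [List.getLast?_cons_cons, ← hlast, List.getLast?_append_cons]
        · exact (pathCostR_le_append hc l₁ _).trans
            (hcost.trans (pathCostR_le_cons hc a _))
      · cases q with
        | nil => simp at hhead
        | cons b' q =>
          obtain rfl : b' = b := by simpa using hhead
          refine ⟨a :: b' :: q, List.nodup_cons.2 ⟨ha, hq⟩, rfl, ?_, ?_⟩
          · rw [List.getLast?_cons_cons, hlast, List.getLast?_cons_cons]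
          · exact add_le_add_right hcost (c a b')

theorem bellmanOp_le {S : Type*} [Fintype S] [Nonempty S] (c V : S → S → ℝ) (s s' g : S) :
    bellmanOp c V s g ≤ c s s' + V s' g :=
  Finset.inf'_le (fun s' => c s s' + V s' g) (Finset.mem_univ s')

/-- The `k`-th term of an approximate Bellman sequence exceeds the cost of any path with at most
`k + 1` edges by at most `(k + 1) * ε`. -/
theorem approx_bellman_le_pathCostR {S : Type*} [Fintype S] [Nonempty S] {c : S → S → ℝ}
    (hdiag : ∀ s : S, c s s = 0) {ε : ℝ} {V : ℕ → S → S → ℝ}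
    {g : S} {k : ℕ} (h0 : ∀ s, V 0 s g ≤ c s g + ε)
    (hstep : ∀ j < k, ∀ s, V (j + 1) s g ≤ bellmanOp c (V j) s g + ε)
    {p : List S} {s : S} (hlen : p.length ≤ k + 2) (hhead : p.head? = some s)
    (hlast : p.getLast? = some g) : V k s g ≤ pathCostR c p + (k + 1) * ε := by
  induction k generalizing p s with
  | zero =>
    have h := h0 s
    match p, hlen, hhead, hlast with
    | [a], _, hhead, hlast =>
      obtain rfl : a = s := by simpa using hhead
      obtain rfl : a = g := by simpa using hlast
      simpa [pathCostR, hdiag] using h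
    | [a, b], _, hhead, hlast =>
      obtain rfl : a = s := by simpa using hhead
      obtain rfl : b = g := by simpa using hlast
      simpa [pathCostR] using h
  | succ k ih =>
    have ih := fun {p s} => @ih (fun j hj => hstep j (by omega)) p s
    have h := hstep k (by omega) s
    push_cast
    match p, hlen, hhead, hlast with
    | [a], _, hhead, hlast =>
      obtain rfl : a = s := by simpa using hhead
      have h₁ := ih (p := [a]) (s := a) (by simp) rfl hlast
      have h₂ := bellmanOp_le c (V k) a a g
      rw [hdiag] at h₂
      linarith
    | a :: b :: p, hlen, hhead, hlast =>
      obtain rfl : a = s := by simpa using hhead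
      have h₁ := ih (p := b :: p) (s := b) (by simpa using hlen) rfl
        (by rwa [List.getLast?_cons_cons] at hlast)
      have h₂ := bellmanOp_le c (V k) a b g
      simp only [pathCostR]
      linarith

/-- The cost of the first `m + 1` greedy steps telescopes, with a loss of `ε` per step after the
first one. -/
theorem greedy_sum_add_le {S : Type*} [Fintype S] [Nonempty S] {c : S → S → ℝ}
    (hdiag : ∀ s : S, c s s = 0) {ε : ℝ} {V : ℕ → S → S → ℝ} {g : S} {n : ℕ}
    (hstep : ∀ j < n, ∀ s, bellmanOp c (V j) s g ≤ V (j + 1) s g + ε) {traj : ℕ → S}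
    (hgreedy : ∀ k ≤ n, ∀ s' : S,
      c (traj k) (traj (k + 1)) + V (n - k) (traj (k + 1)) g ≤ c (traj k) s' + V (n - k) s' g)
    {m : ℕ} (hm : m ≤ n) :
    ∑ k ∈ Finset.range (m + 1), c (traj k) (traj (k + 1)) + V (n - m) (traj (m + 1)) g ≤
      V n (traj 0) g + m * ε := by
  induction m with
  | zero =>
    have h := hgreedy 0 hm (traj 0)
    simpa [hdiag] using h
  | succ m ih =>
    have h₁ : c (traj (m + 1)) (traj (m + 1 + 1)) + V (n - (m + 1)) (traj (m + 1 + 1)) g ≤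
        bellmanOp c (V (n - (m + 1))) (traj (m + 1)) g :=
      Finset.le_inf' _ _ fun s' _ => hgreedy (m + 1) hm s'
    have h₂ := hstep (n - (m + 1)) (by omega) (traj (m + 1))
    rw [show n - (m + 1) + 1 = n - m by omega] at h₂
    have h₃ := ih (by omega)
    rw [Finset.sum_range_succ]
    push_cast
    linarith

/-- Let the graph have `N ≥ 2` vertices, `V̂^B_0, …, V̂^B_{N−1}` an
`ε`-approximate finite-horizon Bellman sequence, and `s_0, …, s_N` the greedy Bellman path
(`s_0 = s`, `s_N = g`, and for `0 ≤ k ≤ N−2`, `s_{k+1}` minimizes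
`c(s_k, s') + V̂^B_{N−k−2}(s', g)`). Then
`Σ_{k=0}^{N−1} c(s_k, s_{k+1}) ≤ V*(s, g) + (N² − N)·ε`. -/
theorem greedy_bellman_path_error {S : Type*} [Fintype S] [Nonempty S]
    (N : ℕ) (hN : 2 ≤ N) (hcard : Fintype.card S = N)
    (c : S → S → ℝ) (hcnn : ∀ s s' : S, 0 ≤ c s s') (hdiag : ∀ s : S, c s s = 0)
    (ε : ℝ) (hε : 0 ≤ ε) (VhatB : ℕ → S → S → ℝ)
    (h0 : ∀ s g : S, |VhatB 0 s g - c s g| ≤ ε)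
    (hstep : ∀ k : ℕ, k < N - 1 → ∀ s g : S,
      |VhatB (k + 1) s g - bellmanOp c (VhatB k) s g| ≤ ε)
    (s g : S) (traj : ℕ → S) (hstart : traj 0 = s) (hgoal : traj N = g)
    (hgreedy : ∀ k : ℕ, k ≤ N - 2 → ∀ s' : S,
      c (traj k) (traj (k + 1)) + VhatB (N - k - 2) (traj (k + 1)) g ≤
        c (traj k) s' + VhatB (N - k - 2) s' g) :
    ∑ k ∈ Finset.range N, c (traj k) (traj (k + 1)) ≤
      VstarR c s g + ((N : ℝ) ^ 2 - (N : ℝ)) * ε := by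
  obtain ⟨n, rfl⟩ := Nat.exists_eq_add_of_le' hN
  subst hstart
  have hsub : ∀ k, n + 2 - k - 2 = n - k := by omega
  simp only [hsub, Nat.add_sub_cancel] at hgreedy
  have htele := greedy_sum_add_le (ε := ε) hdiag
    (fun j hj s => by linarith [(abs_le.1 (hstep j (by omega) s g)).1]) hgreedy le_rfl
  have hlast := (abs_le.1 (h0 (traj (n + 1)) g)).1
  rw [Nat.sub_self] at htele
  have hV : VhatB n (traj 0) g - (n + 1) * ε ≤ VstarR c (traj 0) g := by
    refine le_csInf ⟨_, [traj 0, g], rfl, rfl, rfl⟩ ?_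
    rintro _ ⟨p, hphead, hplast, rfl⟩
    obtain ⟨q, hq, hqhead, hqlast, hcost⟩ := exists_nodup_pathCostR_le hcnn p
    have h := approx_bellman_le_pathCostR hdiag (k := n) (ε := ε)
      (fun s => by linarith [(abs_le.1 (h0 s g)).2])
      (fun j hj s => by linarith [(abs_le.1 (hstep j (by omega) s g)).2])
      (hcard ▸ hq.length_le_card) (hqhead.trans hphead) (hqlast.trans hplast)
    linarith
  rw [Finset.sum_range_succ, hgoal]
  push_cast
  have hn : 0 ≤ ((n : ℝ) ^ 2 + n) * ε := by positivity
  linarith
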